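/- There is no 4×4 non-homogeneous integral Fourier matrix; that is, there is no 4×4 matrix s with rational integer entries such that s_{i0} = 1 for all i, det(s) ≠ 0, √(d_j)·s_{ij} = √(d_i)·s_{ji} for all i, j (where d_i := Σ_j s_{ij}²), N_{ijk} := Σ_l s_{li}·s_{lj}·s_{lk}/d_l is a rational integer for all i, j, k, and the degrees s_{01}², s_{02}², s_{03}² are not all equal. -/

import Mathlib

open Matrix BigOperators

lemma aux_gap (b c : ℤ) (hb : 0 < b) (hc : 0 < c) (h : c ^ 2 = 2 + b ^ 2) : False := by
  have h1 : b < c := by nlinarith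
  nlinarith [mul_self_nonneg (c - b - 1)]

set_option maxHeartbeats 1000000 in
lemma aux_num (a b c x y z w d : ℤ) (ha : 0 < a) (hb : 0 < b) (hc : 0 < c)
    (hac : a ≤ c) (hbc : b ≤ c) (hd : d = 1 + x ^ 2 + y ^ 2 + z ^ 2)
    (hn : d * c ^ 2 = 1 + a ^ 2 + b ^ 2 + c ^ 2)
    (hT : 1 + a * x + b * y + c * z = w * d * c)
    (hne : ¬ (x = a ∧ y = b ∧ z = c)) : a = c ∧ b = c := by
  have hdpos : 0 < d := by rw [hd]; positivity
  have hL : (d * c) ^ 2 * (1 - w ^ 2) = (x - a) ^ 2 + (y - b) ^ 2 + (z - c) ^ 2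
      + (a * y - b * x) ^ 2 + (a * z - c * x) ^ 2 + (b * z - c * y) ^ 2 := by
    have h1 : (d * c) ^ 2 = (1 + x ^ 2 + y ^ 2 + z ^ 2) * (1 + a ^ 2 + b ^ 2 + c ^ 2) := by
      rw [← hn, ← hd]; ring
    have h2 : (d * c) ^ 2 * w ^ 2 = (1 + a * x + b * y + c * z) ^ 2 := by rw [hT]; ring
    linear_combination h1 - h2
  have hpos : 0 < (x - a) ^ 2 + (y - b) ^ 2 + (z - c) ^ 2 := by
    by_contra hcon
    apply hne
    have e1 : (x - a) ^ 2 = 0 := by nlinarith [sq_nonneg (x - a), sq_nonneg (y - b), sq_nonneg (z - c)]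
    have e2 : (y - b) ^ 2 = 0 := by nlinarith [sq_nonneg (x - a), sq_nonneg (y - b), sq_nonneg (z - c)]
    have e3 : (z - c) ^ 2 = 0 := by nlinarith [sq_nonneg (x - a), sq_nonneg (y - b), sq_nonneg (z - c)]
    have e1 := pow_eq_zero_iff (two_ne_zero) |>.1 e1
    have e2 := pow_eq_zero_iff (two_ne_zero) |>.1 e2
    have e3 := pow_eq_zero_iff (two_ne_zero) |>.1 e3
    exact ⟨by linarith, by linarith, by linarith⟩
  have hw : w = 0 := by
    have hp : 0 < (d * c) ^ 2 * (1 - w ^ 2) := by rw [hL]; positivity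
    have h1 : 0 < 1 - w ^ 2 := pos_of_mul_pos_right hp (by positivity)
    have h2 : w < 1 := by nlinarith
    have h3 : -1 < w := by nlinarith
    omega
  subst hw
  have hT' : 1 + a * x + b * y + c * z = 0 := by rw [hT]; ring
  have a2 : a ^ 2 ≤ c ^ 2 := by gcongr
  have b2 : b ^ 2 ≤ c ^ 2 := by gcongr
  have hd4 : d ≤ 4 := by
    by_contra h
    nlinarith [mul_pos hc hc]
  clear hL hpos hT
  have hdd : d = 1 ∨ d = 2 ∨ d = 3 ∨ d = 4 := by omega
  rcases hdd with h | h | h | h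
  · rw [h] at hn; nlinarith [mul_pos ha ha]
  · rw [h] at hn hd
    have hx1 : x ≤ 1 := by nlinarith [sq_nonneg y, sq_nonneg z]
    have hx2 : -1 ≤ x := by nlinarith [sq_nonneg y, sq_nonneg z]
    have hy1 : y ≤ 1 := by nlinarith [sq_nonneg x, sq_nonneg z]
    have hy2 : -1 ≤ y := by nlinarith [sq_nonneg x, sq_nonneg z]
    have hz1 : z ≤ 1 := by nlinarith [sq_nonneg x, sq_nonneg y]
    have hz2 : -1 ≤ z := by nlinarith [sq_nonneg x, sq_nonneg y]
    have ga : a ≠ 1 := by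
      intro e; subst e
      exact aux_gap b c hb hc (by linarith)
    have gb : b ≠ 1 := by
      intro e; subst e
      exact aux_gap a c ha hc (by linarith)
    have gc : c ≠ 1 := by
      intro e; subst e
      nlinarith
    exfalso
    interval_cases x <;> interval_cases y <;> interval_cases z <;> omega
  · rw [h] at hn
    exfalso
    rcases lt_or_eq_of_le hac with h1 | h1
    · rcases lt_or_eq_of_le hbc with h2 | h2
      · nlinarith
      · subst h2
        nlinarith
    · subst h1
      rcases lt_or_eq_of_le hbc with h2 | h2 <;> nlinarith
  · rw [h] at hn
    have : c = 1 := by nlinarith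
    omega

/-- there is no `4 × 4` non-homogeneous integral Fourier matrix. -/
theorem stmt17 :
    ¬ ∃ s : Matrix (Fin 4) (Fin 4) ℤ,
      (∀ i, s i 0 = 1) ∧
      s.det ≠ 0 ∧
      (∀ i j : Fin 4,
        Real.sqrt (∑ l, ((s j l : ℝ)) ^ 2) * (s i j : ℝ) =
        Real.sqrt (∑ l, ((s i l : ℝ)) ^ 2) * (s j i : ℝ)) ∧
      (∀ i j k : Fin 4, ∃ z : ℤ,
        (∑ l, ((s l i : ℚ) * (s l j : ℚ) * (s l k : ℚ)) / (∑ m, ((s l m : ℚ)) ^ 2))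
          = (z : ℚ)) ∧
      ¬ (s 0 1 ^ 2 = s 0 2 ^ 2 ∧ s 0 2 ^ 2 = s 0 3 ^ 2) := by
  rintro ⟨s, h0, hdet, hsym, hN, hnh⟩
  have hdpos : ∀ i, 0 < ∑ l, (s i l) ^ 2 := by
    intro i
    simp only [Fin.sum_univ_four, h0]; positivity
  have hrpos : ∀ i, 0 < Real.sqrt (∑ l, ((s i l : ℝ)) ^ 2) := by
    intro i
    apply Real.sqrt_pos.2
    exact_mod_cast hdpos i
  have hmul : ∀ i, Real.sqrt (∑ l, ((s i l : ℝ)) ^ 2) * (s 0 i : ℝ) =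
      Real.sqrt (∑ l, ((s 0 l : ℝ)) ^ 2) := by
    intro i
    have := hsym 0 i
    simpa [h0 i] using this
  have hapos : ∀ i, 0 < s 0 i := by
    intro i
    have h1 := hrpos 0
    rw [← hmul i] at h1
    have := pos_of_mul_pos_right h1 (hrpos i).le
    exact_mod_cast this
  have hsq : ∀ i, (∑ l, (s i l) ^ 2) * (s 0 i) ^ 2 = ∑ l, (s 0 l) ^ 2 := by
    intro i
    have h1 := congrArg (fun t => t ^ 2) (hmul i)
    simp only [mul_pow] at h1
    rw [Real.sq_sqrt (by positivity), Real.sq_sqrt (by positivity)] at h1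
    exact_mod_cast h1
  have hM : ∀ l i, s 0 l * s l i = s 0 i * s i l := by
    intro l i
    have h1 := hsym l i
    have h2 := hmul l
    have h3 := hmul i
    have hp := hrpos 0
    have h4 : (s 0 l : ℝ) * s l i = s 0 i * s i l := by
      apply mul_left_cancel₀ hp.ne'
      calc _ = (s 0 l : ℝ) * (s 0 i) * (√(∑ m, (s i m : ℝ) ^ 2) * s l i) := by rw [← h3]; ring
        _ = _ := by rw [h1, ← h2]; ring
    exact_mod_cast h4
  have hT : ∀ i, ∃ z : ℤ, ∑ l, s 0 l * s i l = z * (∑ l, (s i l) ^ 2) * s 0 i := by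
    intro i
    obtain ⟨z, hz⟩ := hN 0 i 0
    refine ⟨z, ?_⟩
    have hn : (0 : ℚ) < ∑ l, (s 0 l : ℚ) ^ 2 := by exact_mod_cast hdpos 0
    have hi : (0 : ℚ) < s 0 i := by exact_mod_cast hapos i
    have hsqi : (∑ l, (s i l : ℚ) ^ 2) * (s 0 i : ℚ) ^ 2 = ∑ l, (s 0 l : ℚ) ^ 2 := by
      exact_mod_cast hsq i
    have hterm : ∀ l, ((s l 0 : ℚ) * (s l i : ℚ) * (s l 0 : ℚ)) / (∑ m, ((s l m : ℚ)) ^ 2)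
        = (s 0 i : ℚ) * (s 0 l * s i l) / ∑ m, (s 0 m : ℚ) ^ 2 := by
      intro l
      have hl : (0 : ℚ) < ∑ m, (s l m : ℚ) ^ 2 := by exact_mod_cast hdpos l
      have e1 : (∑ m, (s l m : ℚ) ^ 2) * (s 0 l : ℚ) ^ 2 = ∑ m, (s 0 m : ℚ) ^ 2 := by
        exact_mod_cast hsq l
      have e2 : (s 0 l : ℚ) * s l i = s 0 i * s i l := by exact_mod_cast hM l i
      rw [div_eq_div_iff hl.ne' hn.ne', h0 l, ← e1]
      push_cast
      linear_combination (∑ m, (s l m : ℚ) ^ 2) * (s 0 l : ℚ) * e2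
    rw [Finset.sum_congr rfl (fun l _ => hterm l), ← Finset.sum_div, ← Finset.mul_sum,
      div_eq_iff hn.ne', ← hsqi] at hz
    have : (∑ l, (s 0 l : ℚ) * s i l) = z * (∑ l, (s i l : ℚ) ^ 2) * s 0 i := by
      apply mul_left_cancel₀ hi.ne'
      rw [hz]; ring
    exact_mod_cast this
  have hrow : ∀ i, i ≠ 0 → ¬ (s i 1 = s 0 1 ∧ s i 2 = s 0 2 ∧ s i 3 = s 0 3) := by
    rintro i hi ⟨e1, e2, e3⟩
    apply hdet
    apply Matrix.det_zero_of_row_eq hi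
    funext j
    fin_cases j
    · simp [h0]
    · exact e1
    · exact e2
    · exact e3
  have key1 := hsq 1
  have key2 := hsq 2
  have key3 := hsq 3
  obtain ⟨w1, t1⟩ := hT 1
  obtain ⟨w2, t2⟩ := hT 2
  obtain ⟨w3, t3⟩ := hT 3
  simp only [Fin.sum_univ_four, h0] at key1 key2 key3 t1 t2 t3
  have r1 := hrow 1 (by decide)
  have r2 := hrow 2 (by decide)
  have r3 := hrow 3 (by decide)
  have p1 := hapos 1
  have p2 := hapos 2
  have p3 := hapos 3
  have fin : s 0 1 = s 0 2 ∧ s 0 2 = s 0 3 := by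
    have c1 : s 0 2 ≤ s 0 1 → s 0 3 ≤ s 0 1 → s 0 2 = s 0 1 ∧ s 0 3 = s 0 1 := fun g1 g2 =>
      aux_num (s 0 2) (s 0 3) (s 0 1) (s 1 2) (s 1 3) (s 1 1) w1 _ p2 p3 p1 g1 g2 rfl
        (by linear_combination key1) (by linear_combination t1) (by tauto)
    have c2 : s 0 1 ≤ s 0 2 → s 0 3 ≤ s 0 2 → s 0 1 = s 0 2 ∧ s 0 3 = s 0 2 := fun g1 g2 =>
      aux_num (s 0 1) (s 0 3) (s 0 2) (s 2 1) (s 2 3) (s 2 2) w2 _ p1 p3 p2 g1 g2 rfl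
        (by linear_combination key2) (by linear_combination t2) (by tauto)
    have c3 : s 0 1 ≤ s 0 3 → s 0 2 ≤ s 0 3 → s 0 1 = s 0 3 ∧ s 0 2 = s 0 3 := fun g1 g2 =>
      aux_num (s 0 1) (s 0 2) (s 0 3) (s 3 1) (s 3 2) (s 3 3) w3 _ p1 p2 p3 g1 g2 rfl
        (by linear_combination key3) (by linear_combination t3) (by tauto)
    omega
  exact hnh ⟨by rw [fin.1], by rw [fin.2]⟩
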